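/- arXiv:1809.01598 — 2 statements merged into one kernel-verified Lean document; each statement's English description precedes it below -/
import Mathlib

section
/- B-splines are C^{p−m} at a knot of multiplicity m: if v is a knot value with x_1 < v < x_2 that occurs exactly m times among u_1, …, u_{n+p+1}, where 1 ≤ m ≤ p, then for every j with 1 ≤ j ≤ n the B-spline b_{j,p} is (p − m) times continuously differentiable on an open neighborhood of v. -/
open Finset

/-- B-splines of degree `k` with index `j` (1-based) over the knot sequence `u`,
defined by the Cox–de Boor recurrence; `x2` is the right end point of the basic
interval, at which the B-splines are taken left continuous.  Following the usual
convention, any term whose denominator is zero vanishes (in Lean, division by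
zero is zero, so this is automatic). -/
noncomputable def bspline (u : ℕ → ℝ) (x2 : ℝ) : ℕ → ℕ → ℝ → ℝ
  | 0, j, x =>
      if (u j ≤ x ∧ x < u (j+1)) ∨ (x = x2 ∧ u j < u (j+1) ∧ u (j+1) = x2) then 1 else 0
  | (k+1), j, x =>
      (x - u j) / (u (j+k+1) - u j) * bspline u x2 k j x
      + (u (j+k+2) - x) / (u (j+k+2) - u (j+1)) * bspline u x2 k (j+1) x

/-- The entries `u 1, …, u N` are nondecreasing and take the value `v` exactly at the `m ≥ 1`
consecutive indices `r + 1, …, r + m`, with smaller and larger entries on either side. -/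
structure IsInteriorKnot (u : ℕ → ℝ) (N r m : ℕ) (v : ℝ) : Prop where
  mono : ∀ a b, 1 ≤ a → a ≤ b → b ≤ N → u a ≤ u b
  one_le_index : 1 ≤ r
  index_le : r + m + 1 ≤ N
  one_le_mult : 1 ≤ m
  eq : ∀ i, r < i → i ≤ r + m → u i = v
  left_lt : u r < v
  lt_right : v < u (r + m + 1)

theorem bspline_succ (u : ℕ → ℝ) (x2 : ℝ) (k j : ℕ) (x : ℝ) :
    bspline u x2 (k + 1) j x = (x - u j) / (u (j + k + 1) - u j) * bspline u x2 k j x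
      + (u (j + k + 2) - x) / (u (j + k + 2) - u (j + 1)) * bspline u x2 k (j + 1) x :=
  rfl

theorem bspline_zero_eq_one {u : ℕ → ℝ} {x2 x : ℝ} {j : ℕ} (h₁ : u j ≤ x) (h₂ : x < u (j + 1)) :
    bspline u x2 0 j x = 1 := by
  simp [bspline, h₁, h₂]

theorem bspline_zero_eq_zero {u : ℕ → ℝ} {x2 x : ℝ} {j : ℕ} (hx : x < x2)
    (h : x < u j ∨ u (j + 1) ≤ x) : bspline u x2 0 j x = 0 := by
  rw [bspline, if_neg]
  rintro (⟨h₁, h₂⟩ | ⟨h₁, -⟩)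
  · rcases h with h | h <;> linarith
  · exact hx.ne h₁

/-- Local version of `hasDerivAt_of_hasDerivAt_of_ne`: if `f` has derivative `g` on a punctured
neighborhood of `x`, and `f` and `g` are continuous at `x`, then `f` has derivative `g x` at `x`. -/
theorem hasDerivAt_of_hasDerivAt_punctured {f g : ℝ → ℝ} {s : Set ℝ} {x : ℝ}
    (hs : s ∈ nhds x) (f_diff : ∀ y ∈ s, y ≠ x → HasDerivAt f (g y) y) (hf : ContinuousAt f x)
    (hg : ContinuousAt g x) : HasDerivAt f (g x) x := by
  have A : HasDerivWithinAt f (g x) (Set.Ici x) x := by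
    have hmem : s ∩ Set.Ioi x ∈ nhdsWithin x (Set.Ioi x) :=
      Filter.inter_mem (mem_nhdsWithin_of_mem_nhds hs) self_mem_nhdsWithin
    refine hasDerivWithinAt_Ici_of_tendsto_deriv (s := s ∩ Set.Ioi x)
      (fun y hy => (f_diff y hy.1 hy.2.ne').differentiableAt.differentiableWithinAt)
      hf.continuousWithinAt hmem ((hg.mono_left nhdsWithin_le_nhds).congr' ?_)
    filter_upwards [hmem] with y hy using (f_diff y hy.1 hy.2.ne').deriv.symm
  have B : HasDerivWithinAt f (g x) (Set.Iic x) x := by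
    have hmem : s ∩ Set.Iio x ∈ nhdsWithin x (Set.Iio x) :=
      Filter.inter_mem (mem_nhdsWithin_of_mem_nhds hs) self_mem_nhdsWithin
    refine hasDerivWithinAt_Iic_of_tendsto_deriv (s := s ∩ Set.Iio x)
      (fun y hy => (f_diff y hy.1 hy.2.ne).differentiableAt.differentiableWithinAt)
      hf.continuousWithinAt hmem ((hg.mono_left nhdsWithin_le_nhds).congr' ?_)
    filter_upwards [hmem] with y hy using (f_diff y hy.1 hy.2.ne).deriv.symm
  simpa using B.union A

/-- The derivative formula for B-splines at a point near which those of degree zero are locally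
constant. -/
theorem hasDerivAt_bspline_succ {u : ℕ → ℝ} {x2 x : ℝ} {N : ℕ}
    (mono : ∀ a b, 1 ≤ a → a ≤ b → b ≤ N → u a ≤ u b)
    (h0 : ∀ j, 1 ≤ j → j + 1 ≤ N → HasDerivAt (bspline u x2 0 j) 0 x) (k : ℕ) :
    ∀ j, 1 ≤ j → j + k + 2 ≤ N →
      HasDerivAt (bspline u x2 (k + 1) j)
        ((k + 1) * (bspline u x2 k j x / (u (j + k + 1) - u j)
          - bspline u x2 k (j + 1) x / (u (j + k + 2) - u (j + 1)))) x := by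
  have step : ∀ (k j : ℕ) (d e : ℝ), HasDerivAt (bspline u x2 k j) d x →
      HasDerivAt (bspline u x2 k (j + 1)) e x →
      HasDerivAt (bspline u x2 (k + 1) j)
        (1 / (u (j + k + 1) - u j) * bspline u x2 k j x
          + (x - u j) / (u (j + k + 1) - u j) * d
          + (-1 / (u (j + k + 2) - u (j + 1)) * bspline u x2 k (j + 1) x
          + (u (j + k + 2) - x) / (u (j + k + 2) - u (j + 1)) * e)) x := by
    intro k j d e hd he
    exact ((((hasDerivAt_id x).sub_const (u j)).div_const _).mul hd).add
      ((((hasDerivAt_id x).const_sub (u (j + k + 2))).div_const _).mul he)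
  induction k with
  | zero =>
    intro j hj hN
    convert step 0 j 0 0 (h0 j hj (by omega)) (h0 (j + 1) (by omega) (by omega)) using 1
    push_cast
    ring
  | succ k ih =>
    intro j hj hN
    have h₁ := ih j hj (by omega)
    have h₂ := ih (j + 1) (by omega) (by omega)
    convert step (k + 1) j _ _ h₁ h₂ using 1
    simp only [bspline, show j + 1 + k + 1 = j + k + 2 by ring, show j + 1 + 1 = j + 2 by ring,
      show j + 1 + k + 2 = j + k + 3 by ring, show j + (k + 1) + 1 = j + k + 2 by ring,
      show j + (k + 1) + 2 = j + k + 3 by ring]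
    have m₁ := mono j (j + 1) hj (by omega) (by omega)
    have m₂ := mono (j + 1) (j + k + 2) (by omega) (by omega) (by omega)
    have m₃ := mono (j + k + 2) (j + k + 3) (by omega) (by omega) (by omega)
    have key : (u (j + k + 2) - u (j + 1))⁻¹ *
        ((u (j + k + 2) - u j) * (u (j + k + 2) - u j)⁻¹
          - (u (j + k + 3) - u (j + 1)) * (u (j + k + 3) - u (j + 1))⁻¹) = 0 := by
      rcases m₂.eq_or_lt with h | h
      · simp [h]
      · rw [mul_inv_cancel₀ (by linarith), mul_inv_cancel₀ (by linarith), sub_self, mul_zero]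
    push_cast
    simp only [div_eq_mul_inv]
    linear_combination (k + 1) * bspline u x2 k (j + 1) x * key

namespace IsInteriorKnot

variable {u : ℕ → ℝ} {N r m : ℕ} {v x2 : ℝ}

theorem bspline_zero_of_lt (h : IsInteriorKnot u N r m v) (hx2 : u (r + m + 1) ≤ x2) {x : ℝ}
    (hx : u r < x) (hxv : x < v) {j : ℕ} (hj : 1 ≤ j) (hN : j + 1 ≤ N) :
    bspline u x2 0 j x = if j = r then 1 else 0 := by
  have hm := h.one_le_mult
  have hi := h.index_le
  have hv := h.eq (r + 1) (by omega) (by omega)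
  split_ifs with hjr
  · subst hjr
    exact bspline_zero_eq_one hx.le (by rwa [hv])
  · apply bspline_zero_eq_zero (by linarith [h.lt_right])
    rcases Nat.lt_or_gt_of_ne hjr with hlt | hgt
    · exact Or.inr ((h.mono (j + 1) r (by omega) (by omega) (by omega)).trans hx.le)
    · have := h.mono (r + 1) j (by omega) (by omega) (by omega)
      exact Or.inl (by linarith)

theorem bspline_zero_of_ge (h : IsInteriorKnot u N r m v) (hx2 : u (r + m + 1) ≤ x2) {x : ℝ}
    (hvx : v ≤ x) (hx : x < u (r + m + 1)) {j : ℕ} (hj : 1 ≤ j) (hN : j + 1 ≤ N) :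
    bspline u x2 0 j x = if j = r + m then 1 else 0 := by
  have hm := h.one_le_mult
  have hi := h.index_le
  have hv := h.eq (r + m) (by omega) le_rfl
  split_ifs with hjr
  · subst hjr
    exact bspline_zero_eq_one (by rwa [hv]) hx
  · apply bspline_zero_eq_zero (by linarith)
    rcases Nat.lt_or_gt_of_ne hjr with hlt | hgt
    · have := h.mono (j + 1) (r + m) (by omega) (by omega) (by omega)
      exact Or.inr (by linarith)
    · have := h.mono (r + m + 1) j (by omega) (by omega) (by omega)
      exact Or.inl (by linarith)

theorem hasDerivAt_bspline_zero (h : IsInteriorKnot u N r m v) (hx2 : u (r + m + 1) ≤ x2) {x : ℝ}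
    (hx : x ∈ Set.Ioo (u r) (u (r + m + 1))) (hxv : x ≠ v) {j : ℕ} (hj : 1 ≤ j)
    (hN : j + 1 ≤ N) : HasDerivAt (bspline u x2 0 j) 0 x := by
  rcases lt_or_gt_of_ne hxv with hlt | hgt
  · refine (hasDerivAt_const x (if j = r then (1 : ℝ) else 0)).congr_of_eventuallyEq ?_
    filter_upwards [Ioo_mem_nhds hx.1 hlt] with y hy
    exact h.bspline_zero_of_lt hx2 hy.1 hy.2 hj hN
  · refine (hasDerivAt_const x (if j = r + m then (1 : ℝ) else 0)).congr_of_eventuallyEq ?_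
    filter_upwards [Ioo_mem_nhds hgt hx.2] with y hy
    exact h.bspline_zero_of_ge hx2 hy.1.le hy.2 hj hN

theorem continuousWithinAt_bspline_Ici (h : IsInteriorKnot u N r m v)
    (hx2 : u (r + m + 1) ≤ x2) (k : ℕ) :
    ∀ j, 1 ≤ j → j + k + 1 ≤ N → ContinuousWithinAt (bspline u x2 k j) (Set.Ici v) v := by
  induction k with
  | zero =>
    intro j hj hN
    refine (continuousWithinAt_const (b := if j = r + m then (1 : ℝ) else 0)).congr_of_eventuallyEq
      ?_ (h.bspline_zero_of_ge hx2 le_rfl h.lt_right hj hN)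
    filter_upwards [Ico_mem_nhdsGE h.lt_right] with y hy
    exact h.bspline_zero_of_ge hx2 hy.1 hy.2 hj hN
  | succ k ih =>
    intro j hj hN
    have h₁ := ih j hj (by omega)
    have h₂ := ih (j + 1) (by omega) (by omega)
    simp only [funext (bspline_succ u x2 _ j)]
    fun_prop

/-- At a knot of multiplicity `m`, a B-spline of degree at most `m` jumps by `1`, `-1` or `0`. -/
theorem tendsto_bspline_nhdsLT (h : IsInteriorKnot u N r m v)
    (hx2 : u (r + m + 1) ≤ x2) (k : ℕ) (hk : k ≤ m) :
    ∀ j, 1 ≤ j → j + k + 1 ≤ N → Filter.Tendsto (bspline u x2 k j) (nhdsWithin v (Set.Iio v))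
      (nhds (bspline u x2 k j v
        - ((if j + k = r + m then 1 else 0) - (if j = r then 1 else 0)))) := by
  induction k with
  | zero =>
    intro j hj hN
    rw [h.bspline_zero_of_ge hx2 le_rfl h.lt_right hj hN]
    simp only [add_zero, sub_sub_cancel]
    refine tendsto_const_nhds.congr' ?_
    filter_upwards [Ioo_mem_nhdsLT h.left_lt] with y hy
    exact (h.bspline_zero_of_lt hx2 hy.1 hy.2 hj hN).symm
  | succ k ih =>
    intro j hj hN
    have h₁ := ih (by omega) j hj (by omega)
    have h₂ := ih (by omega) (j + 1) (by omega) (by omega)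
    have c₁ : Filter.Tendsto (fun x => (x - u j) / (u (j + k + 1) - u j))
        (nhdsWithin v (Set.Iio v)) (nhds ((v - u j) / (u (j + k + 1) - u j))) :=
      Filter.Tendsto.mono_left (Continuous.tendsto (by fun_prop) v) nhdsWithin_le_nhds
    have c₂ : Filter.Tendsto (fun x => (u (j + k + 2) - x) / (u (j + k + 2) - u (j + 1)))
        (nhdsWithin v (Set.Iio v)) (nhds ((u (j + k + 2) - v) / (u (j + k + 2) - u (j + 1)))) :=
      Filter.Tendsto.mono_left (Continuous.tendsto (by fun_prop) v) nhdsWithin_le_nhds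
    have e₁ : (v - u j) / (u (j + k + 1) - u j) *
        ((if j + k = r + m then (1 : ℝ) else 0) - (if j = r then 1 else 0))
        = -(if j = r then 1 else 0) := by
      have hl := h.left_lt
      by_cases hjr : j = r
      · subst hjr
        rw [h.eq (j + k + 1) (by omega) (by omega), div_self (by linarith)]
        simp [show k ≠ m by omega]
      · by_cases hjk : j + k = r + m
        · simp [h.eq j (by omega) (by omega), hjr]
        · simp [hjr, hjk]
    have e₂ : (u (j + k + 2) - v) / (u (j + k + 2) - u (j + 1)) *
        ((if j + 1 + k = r + m then (1 : ℝ) else 0) - (if j + 1 = r then 1 else 0))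
        = if j + (k + 1) = r + m then 1 else 0 := by
      have hr := h.lt_right
      rw [show j + (k + 1) = j + 1 + k by ring]
      by_cases hjk : j + 1 + k = r + m
      · rw [h.eq (j + 1) (by omega) (by omega), show j + k + 2 = r + m + 1 by omega,
          div_self (by linarith)]
        simp [hjk, show j + 1 ≠ r by omega]
      · by_cases hjr : j + 1 = r
        · simp [h.eq (j + k + 2) (by omega) (by omega), hjk]
        · simp [hjr, hjk]
    have key := (c₁.mul h₁).add (c₂.mul h₂)
    convert key using 2
    · exact bspline_succ u x2 k j _
    · linear_combination bspline_succ u x2 k j v + e₁ + e₂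

theorem continuousAt_bspline (h : IsInteriorKnot u N r m v) (hx2 : u (r + m + 1) ≤ x2) (d : ℕ) :
    ∀ j, 1 ≤ j → j + (m + d) + 1 ≤ N → ContinuousAt (bspline u x2 (m + d) j) v := by
  induction d with
  | zero =>
    intro j hj hN
    have h₁ : ContinuousWithinAt (bspline u x2 m j) (Set.Iio v) v := by
      simpa [ContinuousWithinAt] using h.tendsto_bspline_nhdsLT hx2 m le_rfl j hj hN
    have h₂ := h.continuousWithinAt_bspline_Ici hx2 m j hj hN
    simpa [continuousWithinAt_univ] using h₁.union h₂
  | succ d ih =>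
    intro j hj hN
    have h₁ := ih j hj (by omega)
    have h₂ := ih (j + 1) (by omega) (by omega)
    rw [← add_assoc]
    simp only [funext (bspline_succ u x2 _ j)]
    fun_prop

theorem continuousAt_bspline_of_mem (h : IsInteriorKnot u N r m v) (hx2 : u (r + m + 1) ≤ x2)
    {d j : ℕ} (hj : 1 ≤ j) (hN : j + (m + d) + 1 ≤ N) {x : ℝ}
    (hx : x ∈ Set.Ioo (u r) (u (r + m + 1))) : ContinuousAt (bspline u x2 (m + d) j) x := by
  rcases eq_or_ne x v with rfl | hxv
  · exact h.continuousAt_bspline hx2 d j hj hN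
  · obtain ⟨k, hk⟩ := Nat.exists_eq_add_of_le' (h.one_le_mult.trans (Nat.le_add_right m d))
    rw [hk]
    exact (hasDerivAt_bspline_succ h.mono
      (fun i hi hiN => h.hasDerivAt_bspline_zero hx2 hx hxv hi hiN) k j hj (by omega)).continuousAt

theorem hasDerivAt_bspline (h : IsInteriorKnot u N r m v) (hx2 : u (r + m + 1) ≤ x2)
    {d j : ℕ} (hj : 1 ≤ j) (hN : j + (m + d) + 2 ≤ N) {x : ℝ}
    (hx : x ∈ Set.Ioo (u r) (u (r + m + 1))) :
    HasDerivAt (bspline u x2 (m + d + 1) j)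
      (((m + d : ℕ) + 1) * (bspline u x2 (m + d) j x / (u (j + (m + d) + 1) - u j)
        - bspline u x2 (m + d) (j + 1) x / (u (j + (m + d) + 2) - u (j + 1)))) x := by
  have off : ∀ y ∈ Set.Ioo (u r) (u (r + m + 1)), y ≠ v → _ := fun y hy hyv =>
    hasDerivAt_bspline_succ h.mono
      (fun i hi hiN => h.hasDerivAt_bspline_zero hx2 hy hyv hi hiN) (m + d) j hj hN
  rcases eq_or_ne x v with rfl | hxv
  · have h₁ := h.continuousAt_bspline hx2 d j hj (by omega)
    have h₂ := h.continuousAt_bspline hx2 d (j + 1) (by omega) (by omega)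
    have h₃ := h.continuousAt_bspline hx2 (d + 1) j hj (by omega)
    exact hasDerivAt_of_hasDerivAt_punctured (Ioo_mem_nhds hx.1 hx.2) off h₃
      (continuousAt_const.mul ((h₁.div_const _).sub (h₂.div_const _)))
  · exact off x hx hxv

theorem contDiffOn_bspline (h : IsInteriorKnot u N r m v) (hx2 : u (r + m + 1) ≤ x2) (d : ℕ) :
    ∀ j, 1 ≤ j → j + (m + d) + 1 ≤ N →
      ContDiffOn ℝ d (bspline u x2 (m + d) j) (Set.Ioo (u r) (u (r + m + 1))) := by
  induction d with
  | zero =>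
    intro j hj hN
    rw [Nat.cast_zero, contDiffOn_zero]
    exact fun x hx => (h.continuousAt_bspline_of_mem hx2 hj hN hx).continuousWithinAt
  | succ d ih =>
    intro j hj hN
    have h₁ := ih j hj (by omega)
    have h₂ := ih (j + 1) (by omega) (by omega)
    have hd := fun x hx => h.hasDerivAt_bspline hx2 (d := d) (x := x) hj (by omega) hx
    rw [Nat.cast_succ, contDiffOn_succ_iff_deriv_of_isOpen isOpen_Ioo]
    refine ⟨fun x hx => (hd x hx).differentiableAt.differentiableWithinAt, by simp, ?_⟩
    refine ContDiffOn.congr ?_ fun x hx => (hd x hx).deriv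
    exact contDiffOn_const.mul ((h₁.div_const _).sub (h₂.div_const _))

end IsInteriorKnot

/-- A nondecreasing finite sequence with entries below and above the value `v`, which occurs
`m ≥ 1` times, has its entries equal to `v` in one block. -/
theorem exists_isInteriorKnot {u : ℕ → ℝ} {N m : ℕ} {v : ℝ}
    (mono : ∀ a b, 1 ≤ a → a ≤ b → b ≤ N → u a ≤ u b) (hN : 1 ≤ N)
    (hl : u 1 < v) (hr : v < u N) (hm : 1 ≤ m)
    (hmult : {i ∈ Finset.Icc 1 N | u i = v}.card = m) :
    ∃ r, IsInteriorKnot u N r m v := by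
  obtain ⟨r, hrm, hrmax⟩ := Finset.exists_max_image {i ∈ Finset.Icc 1 N | u i < v} id
    ⟨1, by simp [hN, hl]⟩
  obtain ⟨t, htm, htmin⟩ := Finset.exists_min_image {i ∈ Finset.Icc 1 N | v < u i} id
    ⟨N, by simp [hN, hr]⟩
  simp only [Finset.mem_filter, Finset.mem_Icc, id] at hrm hrmax htm htmin
  obtain ⟨⟨hr1, hrN⟩, hrv⟩ := hrm
  obtain ⟨⟨ht1, htN⟩, htv⟩ := htm
  have hrt : r < t := by
    by_contra! hc
    linarith [mono t r ht1 hc hrN]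
  have block : ∀ i, r < i → i < t → u i = v := by
    intro i hi hit
    apply le_antisymm
    · by_contra! hc
      have := htmin i ⟨⟨by omega, by omega⟩, hc⟩
      omega
    · by_contra! hc
      have := hrmax i ⟨⟨by omega, by omega⟩, hc⟩
      omega
  have hset : {i ∈ Finset.Icc 1 N | u i = v} = Finset.Ioo r t := by
    ext i
    simp only [Finset.mem_filter, Finset.mem_Icc, Finset.mem_Ioo]
    constructor
    · rintro ⟨⟨hi1, hiN⟩, hiv⟩
      constructor
      · by_contra! hc
        linarith [mono i r hi1 hc hrN]
      · by_contra! hc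
        linarith [mono t i ht1 hc hiN]
    · rintro ⟨hi, hit⟩
      exact ⟨⟨by omega, by omega⟩, block i hi hit⟩
  rw [hset, Nat.card_Ioo] at hmult
  obtain rfl : t = r + m + 1 := by omega
  exact ⟨r, mono, hr1, htN, hm, fun i hi hit => block i hi (by omega), hrv, htv⟩

open scoped Classical in
/-- Smoothness at a knot: at an interior knot value `v` of multiplicity `m`,
every B-spline of degree `p` is `(p-m)` times continuously differentiable on an
open neighborhood of `v`. -/
theorem bspline_smoothness_at_knot
    (p n : ℕ) (hn : p + 1 ≤ n) (u : ℕ → ℝ) (x1 x2 : ℝ)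
    (hmono : ∀ i, 1 ≤ i → i ≤ n + p → u i ≤ u (i+1))
    (hleft : ∀ i, 1 ≤ i → i ≤ p + 1 → u i = x1)
    (hl : x1 < u (p+2))
    (hr : u n < x2)
    (hright : ∀ i, n + 1 ≤ i → i ≤ n + p + 1 → u i = x2)
    (v : ℝ) (hv1 : x1 < v) (hv2 : v < x2)
    (m : ℕ)
    (hmult : m = ((Finset.Icc 1 (n + p + 1)).filter (fun i => u i = v)).card)
    (hm1 : 1 ≤ m) (hmp : m ≤ p) :
    ∀ j, 1 ≤ j → j ≤ n →
      ∃ s : Set ℝ, IsOpen s ∧ v ∈ s ∧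
        ContDiffOn ℝ ((p - m : ℕ) : ℕ∞) (bspline u x2 p j) s := by
  have mono : ∀ a b, 1 ≤ a → a ≤ b → b ≤ n + p + 1 → u a ≤ u b := by
    intro a b ha hab
    induction b, hab using Nat.le_induction with
    | base => exact fun _ => le_rfl
    | succ b hab ih => exact fun hb => (ih (by omega)).trans (hmono b (by omega) (by omega))
  have h1 : u 1 = x1 := hleft 1 le_rfl (by omega)
  have hN : u (n + p + 1) = x2 := hright _ (by omega) le_rfl
  obtain ⟨r, h⟩ := exists_isInteriorKnot mono (by omega) (by rwa [h1]) (by rwa [hN]) hm1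
    (by rw [hmult])
  have hx2 : u (r + m + 1) ≤ x2 := hN ▸ mono _ _ (by omega) h.index_le le_rfl
  obtain ⟨d, rfl⟩ := Nat.exists_eq_add_of_le hmp
  intro j hj hjn
  refine ⟨_, isOpen_Ioo, ⟨h.left_lt, h.lt_right⟩, ?_⟩
  rw [Nat.add_sub_cancel_left]
  exact h.contDiffOn_bspline hx2 d j hj (by omega)
end

section
/- Only the first k+1 (respectively last k+1) B-splines contribute to the k-th derivative at the left (respectively right) end point: for every k with 0 ≤ k ≤ p, the k-th right (one-sided) derivative of b_{j,p} at x_1 is 0 whenever j > k+1, and the k-th left (one-sided) derivative of b_{j,p} at x_2 is 0 whenever j < n−k. -/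
open Finset

/-- The right (one-sided) derivative operator \`D_+\`. -/
noncomputable def rderiv (g : ℝ → ℝ) : ℝ → ℝ := fun y => derivWithin g (Set.Ici y) y

/-- The left (one-sided) derivative operator \`D_-\`. -/
noncomputable def lderiv (g : ℝ → ℝ) : ℝ → ℝ := fun y => derivWithin g (Set.Iic y) y

open Polynomial Topology in
theorem rderiv_iterate_eq_eval {a c : ℝ} (k : ℕ) :
    ∀ (f : ℝ → ℝ) (P : ℝ[X]), (∀ x ∈ Set.Ico a c, f x = P.eval x) →
      ∀ x ∈ Set.Ico a c, rderiv^[k] f x = (derivative^[k] P).eval x := by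
  induction k with
  | zero => exact fun f P h => h
  | succ k ih =>
    intro f P h
    refine ih (rderiv f) (derivative P) fun x hx => ?_
    have heq : f =ᶠ[𝓝[Set.Ici x] x] fun y => P.eval y := by
      filter_upwards [Ico_mem_nhdsGE hx.2] with y hy
      exact h y ⟨hx.1.trans hy.1, hy.2⟩
    rw [rderiv, heq.derivWithin_eq (h x hx)]
    exact P.derivWithin (uniqueDiffOn_Ici x x Set.self_mem_Ici)

open Polynomial Topology in
theorem lderiv_iterate_eq_eval {a c : ℝ} (k : ℕ) :
    ∀ (f : ℝ → ℝ) (P : ℝ[X]), (∀ x ∈ Set.Ioc a c, f x = P.eval x) →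
      ∀ x ∈ Set.Ioc a c, lderiv^[k] f x = (derivative^[k] P).eval x := by
  induction k with
  | zero => exact fun f P h => h
  | succ k ih =>
    intro f P h
    refine ih (lderiv f) (derivative P) fun x hx => ?_
    have heq : f =ᶠ[𝓝[Set.Iic x] x] fun y => P.eval y := by
      filter_upwards [Ioc_mem_nhdsLE hx.1] with y hy
      exact h y ⟨hy.1, hy.2.trans hx.2⟩
    rw [lderiv, heq.derivWithin_eq (h x hx)]
    exact P.derivWithin (uniqueDiffOn_Iic x x Set.self_mem_Iic)

open Polynomial in
theorem eval_iterate_derivative_eq_zero_of_pow_dvd {P : ℝ[X]} {a : ℝ} {m k : ℕ}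
    (h : (X - C a) ^ m ∣ P) (hk : k < m) : (derivative^[k] P).eval a = 0 := by
  have hd : X - C a ∣ derivative^[k] P :=
    (dvd_pow_self _ (Nat.sub_ne_zero_of_lt hk)).trans
      (pow_sub_dvd_iterate_derivative_of_pow_dvd k h)
  exact dvd_iff_isRoot.mp hd

open Polynomial in
/-- The polynomial obtained by applying one Cox–de Boor step to two polynomial pieces. -/
noncomputable def coxDeBoorStep (u : ℕ → ℝ) (k j : ℕ) (P Q : ℝ[X]) : ℝ[X] :=
  C (u (j + k + 1) - u j)⁻¹ * ((X - C (u j)) * P) +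
    C (-(u (j + k + 2) - u (j + 1))⁻¹) * ((X - C (u (j + k + 2))) * Q)

open Polynomial in
theorem bspline_succ_eq_eval_coxDeBoorStep {u : ℕ → ℝ} {x2 : ℝ} {k j : ℕ} {P Q : ℝ[X]} {x : ℝ}
    (hP : bspline u x2 k j x = P.eval x) (hQ : bspline u x2 k (j + 1) x = Q.eval x) :
    bspline u x2 (k + 1) j x = (coxDeBoorStep u k j P Q).eval x := by
  simp only [bspline, hP, hQ, coxDeBoorStep, eval_add, eval_mul, eval_sub, eval_C, eval_X]
  ring

theorem knot_le_knot {N : ℕ} {u : ℕ → ℝ} (hmono : ∀ i, 1 ≤ i → i ≤ N → u i ≤ u (i + 1))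
    {i j : ℕ} (hi : 1 ≤ i) (hij : i ≤ j) (hj : j ≤ N + 1) : u i ≤ u j := by
  induction j, hij using Nat.le_induction with
  | base => exact le_rfl
  | succ j hij ih => exact (ih (by omega)).trans (hmono j (by omega) (by omega))

open Polynomial in
theorem exists_polynomial_eq_bspline_left {p n : ℕ} (hn : p + 1 ≤ n) {u : ℕ → ℝ} {x1 x2 : ℝ}
    (hmono : ∀ i, 1 ≤ i → i ≤ n + p → u i ≤ u (i + 1))
    (hleft : ∀ i, 1 ≤ i → i ≤ p + 1 → u i = x1) (hx2 : u (n + 1) = x2) (k : ℕ) :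
    ∀ j, 1 ≤ j → j + k ≤ n + p → ∃ P : ℝ[X], (X - C x1) ^ (j + k - (p + 1)) ∣ P ∧
      (p + 1 < j → P = 0) ∧ ∀ x ∈ Set.Ico x1 (u (p + 2)), bspline u x2 k j x = P.eval x := by
  induction k with
  | zero =>
    intro j hj1 hj
    have hend : u (p + 2) ≤ x2 := hx2 ▸ knot_le_knot hmono (by omega) (by omega) (by omega)
    rcases eq_or_ne j (p + 1) with rfl | hne
    · refine ⟨1, by simp, by simp, fun x hx => ?_⟩
      have h1 : u (p + 1) ≤ x := (hleft (p + 1) (by omega) le_rfl).trans_le hx.1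
      simp [bspline, h1, hx.2]
    · refine ⟨0, dvd_zero _, fun _ => rfl, fun x hx => ?_⟩
      have hxne : x ≠ x2 := (hx.2.trans_le hend).ne
      have hnot : ¬(u j ≤ x ∧ x < u (j + 1)) := by
        rintro ⟨h1, h2⟩
        rcases lt_or_gt_of_ne hne with h | h
        · rw [hleft (j + 1) (by omega) (by omega)] at h2
          exact absurd hx.1 h2.not_ge
        · exact absurd (knot_le_knot hmono (by omega) h (by omega)) (h1.trans_lt hx.2).not_ge
      simp [bspline, hnot, hxne]
  | succ k ih =>
    intro j hj1 hj
    obtain ⟨P, hPd, hP0, hP⟩ := ih j hj1 (by omega)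
    obtain ⟨Q, hQd, hQ0, hQ⟩ := ih (j + 1) (by omega) (by omega)
    refine ⟨coxDeBoorStep u k j P Q, ?_, ?_,
      fun x hx => bspline_succ_eq_eval_coxDeBoorStep (hP x hx) (hQ x hx)⟩
    · refine dvd_add (Dvd.dvd.mul_left ?_ _) (Dvd.dvd.mul_left (Dvd.dvd.mul_left ?_ _) _)
      · rcases le_or_gt j (p + 1) with h | h
        · rw [hleft j hj1 h]
          refine (pow_dvd_pow _ ?_).trans ((pow_succ' _ _).dvd.trans (mul_dvd_mul_left _ hPd))
          omega
        · simp [hP0 h]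
      · exact (pow_dvd_pow _ (by omega)).trans hQd
    · intro h
      simp [coxDeBoorStep, hP0 h, hQ0 (by omega)]

open Polynomial in
theorem exists_polynomial_eq_bspline_right {p n : ℕ} {u : ℕ → ℝ} {x2 : ℝ}
    (hmono : ∀ i, 1 ≤ i → i ≤ n + p → u i ≤ u (i + 1)) (hr : u n < x2)
    (hright : ∀ i, n + 1 ≤ i → i ≤ n + p + 1 → u i = x2) (k : ℕ) :
    ∀ j, 1 ≤ j → j + k ≤ n + p → ∃ P : ℝ[X], (X - C x2) ^ (n - j) ∣ P ∧
      (j + k < n → P = 0) ∧ ∀ x ∈ Set.Ioc (u n) x2, bspline u x2 k j x = P.eval x := by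
  induction k with
  | zero =>
    intro j hj1 hj
    rcases eq_or_ne j n with rfl | hne
    · refine ⟨1, by simp, by simp, fun x hx => ?_⟩
      have h1 : u (j + 1) = x2 := hright (j + 1) le_rfl (by omega)
      rcases hx.2.eq_or_lt with h | h
      · simp [bspline, h1, h, hr]
      · simp [bspline, h1, h, hx.1.le]
    · refine ⟨0, dvd_zero _, fun _ => rfl, fun x hx => ?_⟩
      rcases lt_or_gt_of_ne hne with h | h
      · have h1 : u (j + 1) ≤ u n := knot_le_knot hmono (by omega) h (by omega)
        have h2 : ¬x < u (j + 1) := (h1.trans hx.1.le).not_gt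
        have h3 : u (j + 1) ≠ x2 := (h1.trans_lt hr).ne
        simp [bspline, h2, h3]
      · have h1 : u j = x2 := hright j h (by omega)
        have h2 : u (j + 1) = x2 := hright (j + 1) (by omega) (by omega)
        simp [bspline, h1, h2]
  | succ k ih =>
    intro j hj1 hj
    obtain ⟨P, hPd, hP0, hP⟩ := ih j hj1 (by omega)
    obtain ⟨Q, hQd, hQ0, hQ⟩ := ih (j + 1) (by omega) (by omega)
    refine ⟨coxDeBoorStep u k j P Q, ?_, ?_,
      fun x hx => bspline_succ_eq_eval_coxDeBoorStep (hP x hx) (hQ x hx)⟩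
    · refine dvd_add (Dvd.dvd.mul_left (Dvd.dvd.mul_left hPd _) _) (Dvd.dvd.mul_left ?_ _)
      rcases lt_or_ge (j + 1 + k) n with h | h
      · simp [hQ0 h]
      · rw [hright (j + k + 2) (by omega) (by omega)]
        refine (pow_dvd_pow _ ?_).trans ((pow_succ' _ _).dvd.trans (mul_dvd_mul_left _ hQd))
        omega
    · intro h
      simp [coxDeBoorStep, hP0 (by omega), hQ0 (by omega)]

/-- Only the first `k+1` (respectively last `k+1`) B-splines contribute to the
`k`-th derivative at the left (respectively right) end point of the basic
interval. -/
theorem bspline_endpoint_derivatives_vanish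
    (p n : ℕ) (hn : p + 1 ≤ n) (u : ℕ → ℝ) (x1 x2 : ℝ)
    (hmono : ∀ i, 1 ≤ i → i ≤ n + p → u i ≤ u (i+1))
    (hleft : ∀ i, 1 ≤ i → i ≤ p + 1 → u i = x1)
    (hl : x1 < u (p+2))
    (hr : u n < x2)
    (hright : ∀ i, n + 1 ≤ i → i ≤ n + p + 1 → u i = x2) :
    ∀ k, k ≤ p → ∀ j, 1 ≤ j → j ≤ n →
      (k + 1 < j → rderiv^[k] (bspline u x2 p j) x1 = 0) ∧
      (j + k < n → lderiv^[k] (bspline u x2 p j) x2 = 0) := by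
  intro k _ j hj1 hjn
  have hx2 : u (n + 1) = x2 := hright (n + 1) le_rfl (by omega)
  constructor
  · intro hkj
    obtain ⟨P, hPd, -, hP⟩ :=
      exists_polynomial_eq_bspline_left hn hmono hleft hx2 p j hj1 (by omega)
    rw [rderiv_iterate_eq_eval k _ P hP x1 ⟨le_rfl, hl⟩]
    exact eval_iterate_derivative_eq_zero_of_pow_dvd hPd (by omega)
  · intro hkj
    obtain ⟨P, hPd, -, hP⟩ :=
      exists_polynomial_eq_bspline_right hmono hr hright p j hj1 (by omega)
    rw [lderiv_iterate_eq_eval k _ P hP x2 ⟨hr, le_rfl⟩]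
    exact eval_iterate_derivative_eq_zero_of_pow_dvd hPd (by omega)
end
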